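/- Let X and Ω be locally compact Hausdorff spaces and let π : C₀(X, ℂ) → B(C₀(Ω, ℂ)) be a non-degenerate representation, i.e. a contractive algebra homomorphism such that the closed linear span of {π(a)ξ : a ∈ C₀(X, ℂ), ξ ∈ C₀(Ω, ℂ)} equals C₀(Ω, ℂ). Then π acts by multiplication operators: there exists a contractive algebra homomorphism π₀ : C₀(X, ℂ) → C_b(Ω, ℂ) (the bounded continuous functions on Ω with the supremum norm) such that (π(a)ξ)(x) = π₀(a)(x)·ξ(x) for all a ∈ C₀(X, ℂ), ξ ∈ C₀(Ω, ℂ) and x ∈ Ω. Moreover π₀ is positive: if a ∈ C₀(X, ℂ) takes nonnegative real values, then so does π₀(a). -/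

import Mathlib

open scoped ZeroAtInfty
open Filter Topology

namespace ZeroAtInftyContinuousMap

variable {X Ω : Type*} [TopologicalSpace X] [TopologicalSpace Ω]

theorem norm_apply_le (ξ : C₀(Ω, ℂ)) (x : Ω) : ‖ξ x‖ ≤ ‖ξ‖ :=
  ξ.toBCF.norm_coe_le_norm x

theorem norm_le_of_forall {ξ : C₀(Ω, ℂ)} {M : ℝ} (hM : 0 ≤ M) (h : ∀ x, ‖ξ x‖ ≤ M) : ‖ξ‖ ≤ M :=
  (BoundedContinuousFunction.norm_le (f := ξ.toBCF) hM).2 h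

theorem exists_bump [LocallyCompactSpace Ω] [T2Space Ω] {x : Ω} {U : Set Ω} (hU : U ∈ 𝓝 x) :
    ∃ η : C₀(Ω, ℂ), η x = 1 ∧ (∀ y ∉ U, η y = 0) ∧
      ∀ y, ∃ r : ℝ, 0 ≤ r ∧ r ≤ 1 ∧ η y = r := by
  obtain ⟨f, hf1, hf0, hfc, hfI⟩ := exists_continuous_one_zero_of_isCompact
    (isCompact_singleton (x := x)) (isOpen_interior (s := U)).isClosed_compl
    (Set.disjoint_singleton_left.2 fun h ↦ h (mem_interior_iff_mem_nhds.2 hU))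
  have hc : HasCompactSupport fun y ↦ (f y : ℂ) :=
    hfc.comp_left (g := fun r : ℝ ↦ (r : ℂ)) Complex.ofReal_zero
  refine ⟨⟨⟨fun y ↦ (f y : ℂ), by fun_prop⟩, hc.is_zero_at_infty⟩, ?_, fun y hy ↦ ?_,
    fun y ↦ ⟨f y, (hfI y).1, (hfI y).2, rfl⟩⟩
  · simpa using! hf1 rfl
  · simpa using! hf0 (fun h ↦ hy (interior_subset h))

theorem exists_norm_le_one_apply_eq_one [LocallyCompactSpace Ω] [T2Space Ω] (x : Ω) :
    ∃ η : C₀(Ω, ℂ), ‖η‖ ≤ 1 ∧ η x = 1 := by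
  obtain ⟨η, hη, -, hr⟩ := exists_bump (x := x) univ_mem
  refine ⟨η, norm_le_of_forall zero_le_one fun y ↦ ?_, hη⟩
  obtain ⟨r, h0, h1, hy⟩ := hr y
  simpa [hy, abs_of_nonneg h0] using h1

variable (X) in
theorem exists_contractive_approximateUnit :
    ∃ l : Filter C₀(X, ℂ), l.NeBot ∧ (∀ᶠ e in l, ‖e‖ ≤ 1) ∧
      ∀ a : C₀(X, ℂ), Tendsto (· * a) l (𝓝 a) := by
  let _ : PartialOrder C₀(X, ℂ) := CStarAlgebra.spectralOrder _
  have _ : StarOrderedRing C₀(X, ℂ) := CStarAlgebra.spectralOrderedRing _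
  have h := CStarAlgebra.increasingApproximateUnit C₀(X, ℂ)
  exact ⟨_, h.neBot, h.eventually_norm, h.tendsto_mul_right⟩

section Representation

variable {E : Type*} [NormedAddCommGroup E] [NormedSpace ℂ E]
  {π : C₀(X, ℂ) →ₙₐ[ℂ] (E →L[ℂ] E)}

theorem tendsto_rep_of_nondegenerate (hcontr : ∀ a, ‖π a‖ ≤ ‖a‖)
    (hnondeg : (Submodule.span ℂ {ξ : E | ∃ a g, π a g = ξ}).topologicalClosure = ⊤)
    {l : Filter C₀(X, ℂ)} (hl : ∀ᶠ e in l, ‖e‖ ≤ 1)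
    (hmul : ∀ a : C₀(X, ℂ), Tendsto (· * a) l (𝓝 a)) (ξ : E) :
    Tendsto (fun e ↦ π e ξ) l (𝓝 ξ) := by
  have hspan : ∀ η ∈ Submodule.span ℂ {ξ : E | ∃ a g, π a g = ξ},
      Tendsto (fun e ↦ π e η) l (𝓝 η) := by
    intro η hη
    induction hη using Submodule.span_induction with
    | mem η h =>
      obtain ⟨a, g, rfl⟩ := h
      rw [tendsto_iff_norm_sub_tendsto_zero]
      have h0 := (tendsto_iff_norm_sub_tendsto_zero.1 (hmul a)).mul_const ‖g‖
      rw [zero_mul] at h0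
      refine squeeze_zero (fun _ ↦ norm_nonneg _) (fun e ↦ ?_) h0
      calc ‖π e (π a g) - π a g‖ = ‖π (e * a - a) g‖ := by simp [map_mul, map_sub]
        _ ≤ ‖π (e * a - a)‖ * ‖g‖ := ContinuousLinearMap.le_opNorm _ _
        _ ≤ _ := by gcongr; exact hcontr _
    | zero => simpa using tendsto_const_nhds
    | add η ζ _ _ h1 h2 => simpa using h1.add h2
    | smul c η _ h => simpa using h.const_smul c
  rw [Metric.tendsto_nhds]
  intro ε hε
  have hξ : ξ ∈ closure (Submodule.span ℂ {ξ : E | ∃ a g, π a g = ξ} : Set E) := by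
    rw [← Submodule.topologicalClosure_coe, hnondeg]; trivial
  obtain ⟨η, hη, hd⟩ := Metric.mem_closure_iff.1 hξ (ε / 3) (by positivity)
  filter_upwards [hl, Metric.tendsto_nhds.1 (hspan η hη) (ε / 3) (by positivity)] with e he h
  have h1 : dist (π e ξ) (π e η) ≤ dist ξ η := by
    rw [dist_eq_norm, dist_eq_norm, ← map_sub]
    calc _ ≤ ‖π e‖ * ‖ξ - η‖ := ContinuousLinearMap.le_opNorm _ _
      _ ≤ 1 * ‖ξ - η‖ := by gcongr; exact (hcontr e).trans he
      _ = _ := one_mul _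
  have h2 := dist_triangle4 (π e ξ) (π e η) η ξ
  rw [dist_comm η ξ] at h2
  linarith

/-- The extension of a non-degenerate contractive representation to the unitization is
contractive. -/
theorem norm_smul_add_rep_le (hcontr : ∀ a, ‖π a‖ ≤ ‖a‖)
    (hnondeg : (Submodule.span ℂ {ξ : E | ∃ a g, π a g = ξ}).topologicalClosure = ⊤)
    {c : ℂ} {a : C₀(X, ℂ)} {M : ℝ} (hM : 0 ≤ M) (h : ∀ t, ‖c + a t‖ ≤ M) (ξ : E) :
    ‖c • ξ + π a ξ‖ ≤ M * ‖ξ‖ := by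
  obtain ⟨l, _, hl, hmul⟩ := exists_contractive_approximateUnit X
  have ht := tendsto_rep_of_nondegenerate hcontr hnondeg hl hmul
  have hlim := (((ht ξ).const_smul c).add (ht (π a ξ))).norm
  refine le_of_tendsto hlim ?_
  filter_upwards [hl] with e he
  calc ‖c • π e ξ + π e (π a ξ)‖ = ‖π (c • e + e * a) ξ‖ := by simp [map_mul, map_add, map_smul]
    _ ≤ ‖π (c • e + e * a)‖ * ‖ξ‖ := ContinuousLinearMap.le_opNorm _ _
    _ ≤ M * ‖ξ‖ := by
      gcongr
      refine (hcontr _).trans (norm_le_of_forall hM fun t ↦ ?_)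
      calc ‖(c • e + e * a) t‖ = ‖e t‖ * ‖c + a t‖ := by
            rw [← norm_mul]; congr 1; simp; ring
        _ ≤ 1 * M := by gcongr; exacts [(norm_apply_le e t).trans he, h t]
        _ = M := one_mul M

end Representation

section NumericalRange

variable {π : C₀(X, ℂ) →ₙₐ[ℂ] (C₀(Ω, ℂ) →L[ℂ] C₀(Ω, ℂ))}

theorem norm_add_rep_apply_le (hcontr : ∀ a, ‖π a‖ ≤ ‖a‖)
    (hnondeg : (Submodule.span ℂ {ξ : C₀(Ω, ℂ) | ∃ a g, π a g = ξ}).topologicalClosure = ⊤)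
    {c : ℂ} {a : C₀(X, ℂ)} {M : ℝ} (hM : 0 ≤ M) (h : ∀ t, ‖c + a t‖ ≤ M)
    {ξ : C₀(Ω, ℂ)} (hξ : ‖ξ‖ ≤ 1) {x : Ω} (hx : ξ x = 1) :
    ‖c + π a ξ x‖ ≤ M := by
  calc ‖c + π a ξ x‖ = ‖(c • ξ + π a ξ) x‖ := by simp [hx]
    _ ≤ ‖c • ξ + π a ξ‖ := norm_apply_le _ _
    _ ≤ M * ‖ξ‖ := norm_smul_add_rep_le hcontr hnondeg hM h ξ
    _ ≤ M * 1 := by gcongr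
    _ = M := mul_one M

theorem im_rep_apply_eq_zero (hcontr : ∀ a, ‖π a‖ ≤ ‖a‖)
    (hnondeg : (Submodule.span ℂ {ξ : C₀(Ω, ℂ) | ∃ a g, π a g = ξ}).topologicalClosure = ⊤)
    {a : C₀(X, ℂ)} (ha : ∀ t, (a t).im = 0)
    {ξ : C₀(Ω, ℂ)} (hξ : ‖ξ‖ ≤ 1) {x : Ω} (hx : ξ x = 1) : (π a ξ x).im = 0 := by
  set z := π a ξ x with hz
  have key (s : ℝ) : (s + z.im) ^ 2 ≤ s ^ 2 + ‖a‖ ^ 2 := by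
    have hb : ‖(s * Complex.I : ℂ) + z‖ ≤ √(s ^ 2 + ‖a‖ ^ 2) := by
      refine norm_add_rep_apply_le hcontr hnondeg (Real.sqrt_nonneg _) (fun t ↦ ?_) hξ hx
      refine Real.le_sqrt_of_sq_le ?_
      have h1 : (a t).re ^ 2 ≤ ‖a‖ ^ 2 :=
        sq_le_sq' (neg_le_of_abs_le ((Complex.abs_re_le_norm _).trans (norm_apply_le a t)))
          (le_of_abs_le ((Complex.abs_re_le_norm _).trans (norm_apply_le a t)))
      rw [← Complex.normSq_eq_norm_sq, Complex.normSq_apply]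
      simp only [Complex.add_re, Complex.add_im, Complex.mul_re, Complex.mul_im,
        Complex.ofReal_re, Complex.ofReal_im, Complex.I_re, Complex.I_im, ha t]
      nlinarith
    have h2 := (Real.le_sqrt (norm_nonneg _) (by positivity)).1 hb
    rw [← Complex.normSq_eq_norm_sq, Complex.normSq_apply] at h2
    simp only [Complex.add_re, Complex.add_im, Complex.mul_re, Complex.mul_im,
      Complex.ofReal_re, Complex.ofReal_im, Complex.I_re, Complex.I_im] at h2
    nlinarith [sq_nonneg z.re]
  by_contra hne
  have h := key ((‖a‖ ^ 2 + 1) / (2 * z.im))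
  have h3 : (‖a‖ ^ 2 + 1) / (2 * z.im) * z.im * 2 = ‖a‖ ^ 2 + 1 := by field_simp
  nlinarith [sq_nonneg z.im]

theorem re_rep_apply_nonneg (hcontr : ∀ a, ‖π a‖ ≤ ‖a‖)
    (hnondeg : (Submodule.span ℂ {ξ : C₀(Ω, ℂ) | ∃ a g, π a g = ξ}).topologicalClosure = ⊤)
    {a : C₀(X, ℂ)} (ha : ∀ t, 0 ≤ (a t).re ∧ (a t).im = 0)
    {ξ : C₀(Ω, ℂ)} (hξ : ‖ξ‖ ≤ 1) {x : Ω} (hx : ξ x = 1) : 0 ≤ (π a ξ x).re := by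
  have hb : ‖(-‖a‖ : ℂ) + π a ξ x‖ ≤ ‖a‖ := by
    refine norm_add_rep_apply_le hcontr hnondeg (norm_nonneg a) (fun t ↦ ?_) hξ hx
    have h1 : (a t).re ≤ ‖a‖ := (Complex.re_le_norm _).trans (norm_apply_le a t)
    have h2 : (-‖a‖ : ℂ) + a t = ((-‖a‖ + (a t).re : ℝ) : ℂ) := by
      apply Complex.ext <;> simp [ha t]
    rw [h2, Complex.norm_real, Real.norm_eq_abs, abs_le]
    constructor <;> linarith [(ha t).1]
  have h := (Complex.abs_re_le_norm _).trans hb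
  rw [abs_le] at h
  simp only [Complex.add_re, Complex.neg_re, Complex.ofReal_re] at h
  linarith

variable [LocallyCompactSpace Ω] [T2Space Ω]

/-- A bounded operator on `C₀(Ω, ℂ)` whose numerical range is real is local. -/
theorem apply_eq_zero_of_real_numericalRange {T : C₀(Ω, ℂ) →L[ℂ] C₀(Ω, ℂ)} {x : Ω}
    (hT : ∀ ξ : C₀(Ω, ℂ), ‖ξ‖ ≤ 1 → ξ x = 1 → (T ξ x).im = 0)
    {ξ : C₀(Ω, ℂ)} (hξ : ξ x = 0) : T ξ x = 0 := by
  wlog hn : ‖ξ‖ ≤ 1 generalizing ξ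
  · have h0 : (‖ξ‖ : ℂ) ≠ 0 := by
      rw [Complex.ofReal_ne_zero]; rintro h; rw [h] at hn; exact hn zero_le_one
    have h := this (ξ := (‖ξ‖ : ℂ)⁻¹ • ξ) (by simp [hξ])
      (by rw [norm_smul]; simp [inv_mul_cancel₀ (Complex.ofReal_ne_zero.1 h0)])
    simpa [h0] using h
  rw [← norm_eq_zero]
  refine le_antisymm (le_of_forall_pos_le_add fun ε hε ↦ ?_) (norm_nonneg _)
  obtain ⟨δ, hδ, hδε⟩ : ∃ δ > 0, ‖T‖ * δ ≤ ε := by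
    refine ⟨ε / (‖T‖ + 1), by positivity, ?_⟩
    rw [mul_div_assoc', div_le_iff₀ (by positivity)]
    nlinarith [norm_nonneg T]
  have hU : {y | ‖ξ y‖ < δ} ∈ 𝓝 x :=
    (isOpen_lt (map_continuous ξ).norm continuous_const).mem_nhds (by simpa [hξ])
  obtain ⟨η, hηx, hη0, hηr⟩ := exists_bump hU
  set ζ := ξ - η * ξ with hζ
  have hζx : ζ x = 0 := by simp [hζ, hξ]
  have hsmall : ‖η * ξ‖ ≤ δ := by
    refine norm_le_of_forall hδ.le fun y ↦ ?_
    by_cases hy : ‖ξ y‖ < δ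
    · obtain ⟨r, h0, h1, hr⟩ := hηr y
      rw [mul_apply, hr, norm_mul, Complex.norm_real, Real.norm_of_nonneg h0]
      nlinarith [norm_nonneg (ξ y)]
    · simp [hη0 y hy, hδ.le]
  have hnum (w : ℂ) (hw : ‖w‖ ≤ 1) : (T η x + w * T ζ x).im = 0 := by
    have h := hT (η + w • ζ) (norm_le_of_forall zero_le_one fun y ↦ ?_) (by simp [hηx, hζx])
    · simpa using h
    · obtain ⟨r, h0, h1, hr⟩ := hηr y
      have hy := (norm_apply_le ξ y).trans hn
      calc ‖(η + w • ζ) y‖ = ‖(r : ℂ) + w * ((1 - r : ℝ) * ξ y)‖ := by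
            simp [hζ, hr]; ring_nf
        _ ≤ ‖(r : ℂ)‖ + ‖w * ((1 - r : ℝ) * ξ y)‖ := norm_add_le _ _
        _ = r + ‖w‖ * ((1 - r) * ‖ξ y‖) := by
            rw [norm_mul, norm_mul, Complex.norm_real, Complex.norm_real,
              Real.norm_of_nonneg h0, Real.norm_of_nonneg (sub_nonneg.2 h1)]
        _ ≤ r + 1 * ((1 - r) * 1) := by
            have := sub_nonneg.2 h1
            gcongr
        _ = 1 := by ring
  have hz0 := hnum 0 (by simp)
  have hz1 := hnum 1 (by simp)
  have hzI := hnum Complex.I (by simp)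
  have hTζ : T ζ x = 0 := by
    apply Complex.ext <;> simp_all
  have hsplit : T ξ x = T (η * ξ) x := by
    rw [← sub_eq_zero, ← sub_apply, ← map_sub]; exact hTζ
  rw [hsplit, zero_add]
  calc _ ≤ ‖T (η * ξ)‖ := norm_apply_le _ _
    _ ≤ ‖T‖ * ‖η * ξ‖ := T.le_opNorm _
    _ ≤ ‖T‖ * δ := by gcongr
    _ ≤ ε := hδε

theorem rep_apply_eq_zero (hcontr : ∀ a, ‖π a‖ ≤ ‖a‖)
    (hnondeg : (Submodule.span ℂ {ξ : C₀(Ω, ℂ) | ∃ a g, π a g = ξ}).topologicalClosure = ⊤)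
    (a : C₀(X, ℂ)) {ξ : C₀(Ω, ℂ)} {x : Ω} (hξ : ξ x = 0) : π a ξ x = 0 := by
  have hsa (b : selfAdjoint C₀(X, ℂ)) : π b ξ x = 0 := by
    refine apply_eq_zero_of_real_numericalRange (fun η hη hx ↦
      im_rep_apply_eq_zero hcontr hnondeg (fun t ↦ ?_) hη hx) hξ
    have h := DFunLike.congr_fun b.2.star_eq t
    exact Complex.conj_eq_iff_im.1 h
  have h : π a ξ x = π (realPart a) ξ x + Complex.I * π (imaginaryPart a) ξ x := by
    conv_lhs => rw [← realPart_add_I_smul_imaginaryPart a]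
    simp [map_add, map_smul]
  rw [h, hsa, hsa, mul_zero, add_zero]

theorem rep_apply_eq_mul (hcontr : ∀ a, ‖π a‖ ≤ ‖a‖)
    (hnondeg : (Submodule.span ℂ {ξ : C₀(Ω, ℂ) | ∃ a g, π a g = ξ}).topologicalClosure = ⊤)
    (a : C₀(X, ℂ)) {η : C₀(Ω, ℂ)} {x : Ω} (hη : η x = 1) (ξ : C₀(Ω, ℂ)) :
    π a ξ x = π a η x * ξ x := by
  have h := rep_apply_eq_zero hcontr hnondeg a (ξ := ξ - ξ x • η) (x := x) (by simp [hη])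
  rw [map_sub, map_smul, sub_apply, smul_apply, sub_eq_zero] at h
  rw [h, smul_eq_mul, mul_comm]

end NumericalRange

end ZeroAtInftyContinuousMap

open ZeroAtInftyContinuousMap

/-- A non-degenerate representation `π` of `C₀(X, ℂ)` on the Banach space `C₀(Ω, ℂ)` acts by
multiplication operators: there is a contractive algebra homomorphism
`π₀ : C₀(X, ℂ) → C_b(Ω, ℂ)` with `(π(a)ξ)(x) = π₀(a)(x)·ξ(x)`, and `π₀` is positive: it maps
functions with nonnegative real values to functions with nonnegative real values. -/
theorem nondegenerate_rep_on_C0_is_multiplication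
    {X : Type*} [TopologicalSpace X] [LocallyCompactSpace X] [T2Space X]
    {Ω : Type*} [TopologicalSpace Ω] [LocallyCompactSpace Ω] [T2Space Ω]
    (π : C₀(X, ℂ) →ₙₐ[ℂ] (C₀(Ω, ℂ) →L[ℂ] C₀(Ω, ℂ)))
    (hcontr : ∀ a : C₀(X, ℂ), ‖π a‖ ≤ ‖a‖)
    (hnondeg : (Submodule.span ℂ
        {ξ : C₀(Ω, ℂ) | ∃ (a : C₀(X, ℂ)) (g : C₀(Ω, ℂ)), π a g = ξ}).topologicalClosure = ⊤) :
    ∃ π₀ : C₀(X, ℂ) → BoundedContinuousFunction Ω ℂ,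
      (∀ a b : C₀(X, ℂ), π₀ (a + b) = π₀ a + π₀ b) ∧
      (∀ (c : ℂ) (a : C₀(X, ℂ)), π₀ (c • a) = c • π₀ a) ∧
      (∀ a b : C₀(X, ℂ), π₀ (a * b) = π₀ a * π₀ b) ∧
      (∀ a : C₀(X, ℂ), ‖π₀ a‖ ≤ ‖a‖) ∧
      (∀ (a : C₀(X, ℂ)) (ξ : C₀(Ω, ℂ)) (x : Ω), π a ξ x = π₀ a x * ξ x) ∧
      (∀ a : C₀(X, ℂ), (∀ t : X, 0 ≤ (a t).re ∧ (a t).im = 0) →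
        ∀ x : Ω, 0 ≤ (π₀ a x).re ∧ (π₀ a x).im = 0) := by
  choose η hη1 hηx using exists_norm_le_one_apply_eq_one (Ω := Ω)
  have hmul (a : C₀(X, ℂ)) (ξ : C₀(Ω, ℂ)) (x : Ω) : π a ξ x = π a (η x) x * ξ x :=
    rep_apply_eq_mul hcontr hnondeg a (hηx x) ξ
  have hbound (a : C₀(X, ℂ)) (x : Ω) : ‖π a (η x) x‖ ≤ ‖a‖ :=
    calc ‖π a (η x) x‖ ≤ ‖π a (η x)‖ := norm_apply_le _ _
      _ ≤ ‖π a‖ * ‖η x‖ := (π a).le_opNorm _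
      _ ≤ ‖a‖ * 1 := by gcongr; exacts [hcontr a, hη1 x]
      _ = ‖a‖ := mul_one _
  have hcont (a : C₀(X, ℂ)) : Continuous fun x ↦ π a (η x) x := by
    refine continuous_iff_continuousAt.2 fun x ↦ ?_
    have hne : ∀ᶠ y in 𝓝 x, η x y ≠ 0 :=
      (map_continuous (η x)).continuousAt.eventually_ne (by simp [hηx])
    refine ContinuousAt.congr (f := fun y ↦ π a (η x) y / η x y) ?_ ?_
    · exact (map_continuous _).continuousAt.div (map_continuous _).continuousAt (by simp [hηx])
    · filter_upwards [hne] with y hy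
      rw [hmul a (η x) y, mul_div_cancel_right₀ _ hy]
  refine ⟨fun a ↦ .ofNormedAddCommGroup _ (hcont a) ‖a‖ (hbound a), fun a b ↦ ?_, fun c a ↦ ?_,
    fun a b ↦ ?_, fun a ↦ ?_, hmul, fun a ha x ↦ ?_⟩
  · ext x; simp [map_add]
  · ext x; simp [map_smul]
  · ext x
    simpa [map_mul] using hmul a (π b (η x)) x
  · exact BoundedContinuousFunction.norm_ofNormedAddCommGroup_le _ (norm_nonneg a) (hbound a)
  · exact ⟨re_rep_apply_nonneg hcontr hnondeg ha (hη1 x) (hηx x),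
      im_rep_apply_eq_zero hcontr hnondeg (fun t ↦ (ha t).2) (hη1 x) (hηx x)⟩
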